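/- Let G be a torsion-free abelian group and A ⊆ G \ {0} a subset with |A| ≤ 12 such that ∑_{z∈A} z = 0 and A contains no pair {x, −x}. Then there exists an ordering of the elements of A such that the partial sums are pairwise distinct. -/

import Mathlib

/-- A torsion-free abelian group admits a compatible linear order. -/
theorem exists_linearOrder_isOrderedAddMonoid (G : Type*) [AddCommGroup G] [IsAddTorsionFree G] :
    ∃ _ : LinearOrder G, IsOrderedAddMonoid G := by
  classical
  let b := Module.Basis.ofVectorSpace ℚ (DivisibleHull G)
  let _ : LinearOrder (Module.Basis.ofVectorSpaceIndex ℚ (DivisibleHull G)) :=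
    linearOrderOfSTO WellOrderingRel
  let f : G → Lex (Module.Basis.ofVectorSpaceIndex ℚ (DivisibleHull G) →₀ ℚ) :=
    fun g ↦ toLex (b.repr (DivisibleHull.coeAddMonoidHom G g))
  have hf : Function.Injective f :=
    toLex.injective.comp (b.repr.injective.comp DivisibleHull.coe_injective)
  have hadd (x y : G) : f (x + y) = f x + f y := by simp [f, map_add]
  let _ : LinearOrder G := LinearOrder.lift' f hf
  refine ⟨inferInstance, { add_le_add_left := fun x y hxy z ↦ ?_ }⟩
  change f (x + z) ≤ f (y + z)
  rw [hadd, hadd]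
  exact add_le_add_left (show f x ≤ f y from hxy) (f z)

section Ordered

variable {G : Type*} [AddCommGroup G] [LinearOrder G] [IsOrderedAddMonoid G]

/-- A finite set with positive sum contains a positive element whose removal leaves either
nothing or a set with nonzero sum. -/
theorem Finset.exists_pos_erase_eq_empty_or_sum_ne_zero {A : Finset G} (hA0 : (0 : G) ∉ A)
    (hsum : 0 < ∑ z ∈ A, z) :
    ∃ p ∈ A, 0 < p ∧ (A.erase p = ∅ ∨ ∑ z ∈ A.erase p, z ≠ 0) := by
  by_contra! H
  obtain ⟨p, hpA, hp⟩ : ∃ p ∈ A, 0 < p := by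
    by_contra! h
    exact hsum.not_ge (Finset.sum_nonpos h)
  obtain ⟨hne, hsp⟩ := H p hpA hp
  obtain ⟨r, hr⟩ := hne
  obtain ⟨q, hq, hq0⟩ := Finset.exists_pos_of_sum_zero_of_exists_nonzero (fun z ↦ z) hsp
    ⟨r, hr, fun h ↦ hA0 (h ▸ Finset.mem_of_mem_erase hr)⟩
  have hqA := Finset.mem_of_mem_erase hq
  have hsq := (H q hqA hq0).2
  have h1 := Finset.sum_erase_add A (fun z ↦ z) hpA
  have h2 := Finset.sum_erase_add A (fun z ↦ z) hqA
  refine Finset.ne_of_mem_erase hq ?_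
  simp_all

/-- A finite set with negative sum contains a negative element whose removal leaves either
nothing or a set with nonzero sum. -/
theorem Finset.exists_neg_erase_eq_empty_or_sum_ne_zero {A : Finset G} (hA0 : (0 : G) ∉ A)
    (hsum : ∑ z ∈ A, z < 0) :
    ∃ p ∈ A, p < 0 ∧ (A.erase p = ∅ ∨ ∑ z ∈ A.erase p, z ≠ 0) := by
  have hneg (B : Finset G) : ∑ z ∈ B.map (Equiv.neg G).toEmbedding, z = -∑ z ∈ B, z :=
    (Finset.sum_map ..).trans (Finset.sum_neg_distrib ..)
  obtain ⟨_, hp, hp0, he⟩ := Finset.exists_pos_erase_eq_empty_or_sum_ne_zero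
    (A := A.map (Equiv.neg G).toEmbedding) (by simpa using hA0) (hneg A ▸ neg_pos.mpr hsum)
  obtain ⟨p, hpA, rfl⟩ := Finset.mem_map.mp hp
  rw [← Finset.map_erase, hneg, neg_ne_zero, Finset.map_eq_empty] at he
  exact ⟨p, hpA, neg_pos.mp hp0, he⟩

theorem List.sum_neg_of_forall_neg {l : List G} (hl : ∀ x ∈ l, x < 0) (hne : l ≠ []) :
    l.sum < 0 := by
  rw [← neg_pos, List.sum_neg_reverse]
  exact List.sum_pos _ (by simpa using fun x hx ↦ hl (-x) hx) (by simpa using hne)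

theorem List.sum_pos_of_suffix_append {N P s : List G} (hN : ∀ x ∈ N, x < 0)
    (hP : ∀ x ∈ P, 0 < x) (hsum : 0 < (N ++ P).sum) (hs : s <:+ N ++ P) (hne : s ≠ []) :
    0 < s.sum := by
  obtain ⟨t, ht⟩ := hs
  rcases List.append_eq_append_iff.mp ht with ⟨c, rfl, rfl⟩ | ⟨c, rfl, rfl⟩
  · rcases eq_or_ne t [] with rfl | ht
    · exact hsum
    have h := List.sum_neg_of_forall_neg (fun x hx ↦ hN x (List.mem_append_left c hx)) ht
    rw [List.append_assoc, List.sum_append] at hsum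
    exact hsum.trans (add_lt_of_neg_left _ h)
  · exact List.sum_pos _ (fun x hx ↦ hP x (by simp [hx])) hne

theorem List.sum_neg_of_prefix_append {N P s : List G} (hN : ∀ x ∈ N, x < 0)
    (hP : ∀ x ∈ P, 0 < x) (hsum : (N ++ P).sum < 0) (hs : s <+: N ++ P) (hne : s ≠ []) :
    s.sum < 0 := by
  obtain ⟨t, ht⟩ := hs
  rcases List.append_eq_append_iff.mp ht with ⟨c, rfl, rfl⟩ | ⟨c, rfl, rfl⟩
  · exact List.sum_neg_of_forall_neg (fun x hx ↦ hN x (List.mem_append_left c hx)) hne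
  · rcases eq_or_ne t [] with rfl | ht
    · simpa using hsum
    have h := List.sum_pos t (fun x hx ↦ hP x (List.mem_append_right c hx)) ht
    rw [← List.append_assoc, List.sum_append] at hsum
    exact (lt_add_of_pos_right _ h).trans hsum

/-- In a linearly ordered abelian group, a finite set of nonzero elements with nonzero sum can be
listed, negative elements first, so that no nonempty block of consecutive elements sums to zero. -/
theorem Finset.exists_neg_append_pos_infix_sum_ne_zero (A : Finset G) (hA0 : (0 : G) ∉ A)
    (hsum : A = ∅ ∨ ∑ z ∈ A, z ≠ 0) :
    ∃ N P : List G, (∀ x ∈ N, x < 0) ∧ (∀ x ∈ P, 0 < x) ∧ (N ++ P).Nodup ∧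
      (N ++ P).toFinset = A ∧ ∀ s, s <:+: N ++ P → s ≠ [] → s.sum ≠ 0 := by
  induction A using Finset.strongInduction with
  | H A ih =>
    rcases hsum with rfl | hsum
    · exact ⟨[], [], by simp⟩
    have extend {p : G} (hp : p ∈ A) (he : A.erase p = ∅ ∨ ∑ z ∈ A.erase p, z ≠ 0) :=
      ih _ (Finset.erase_ssubset hp) (fun h ↦ hA0 (Finset.mem_of_mem_erase h)) he
    have sum_list {l : List G} (hl : l.Nodup) (h : l.toFinset = A) : l.sum = ∑ z ∈ A, z := by
      rw [← h, List.sum_toFinset _ hl, List.map_id']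
    rcases hsum.lt_or_gt with hneg | hpos
    · obtain ⟨p, hpA, hp, he⟩ :=
        Finset.exists_neg_erase_eq_empty_or_sum_ne_zero hA0 hneg
      obtain ⟨N, P, hN, hP, hnd, hmem, hinf⟩ := extend hpA he
      have hN' : ∀ x ∈ p :: N, x < 0 := List.forall_mem_cons.mpr ⟨hp, hN⟩
      have hnd' : (p :: N ++ P).Nodup :=
        List.nodup_cons.mpr ⟨fun h ↦ by simpa [hmem] using List.mem_toFinset.mpr h, hnd⟩
      have hmem' : (p :: N ++ P).toFinset = A := by
        rw [List.cons_append, List.toFinset_cons, hmem, Finset.insert_erase hpA]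
      refine ⟨p :: N, P, hN', hP, hnd', hmem', fun s hs hne ↦ ?_⟩
      rcases List.infix_cons_iff.mp hs with h | h
      · exact (List.sum_neg_of_prefix_append hN' hP (sum_list hnd' hmem' ▸ hneg) h hne).ne
      · exact hinf s h hne
    · obtain ⟨p, hpA, hp, he⟩ := Finset.exists_pos_erase_eq_empty_or_sum_ne_zero hA0 hpos
      obtain ⟨N, P, hN, hP, hnd, hmem, hinf⟩ := extend hpA he
      have hP' : ∀ x ∈ P ++ [p], 0 < x :=
        List.forall_mem_append.mpr ⟨hP, List.forall_mem_singleton.mpr hp⟩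
      have hnd' : (N ++ (P ++ [p])).Nodup := by
        rw [← List.append_assoc, ← List.concat_eq_append]
        exact hnd.concat fun h ↦ by simpa [hmem] using List.mem_toFinset.mpr h
      have hmem' : (N ++ (P ++ [p])).toFinset = A := by
        rw [← List.append_assoc, List.toFinset_append, hmem]
        simp [hpA]
      refine ⟨N, P ++ [p], hN, hP', hnd', hmem', fun s hs hne ↦ ?_⟩
      rw [← List.append_assoc] at hs
      rcases List.infix_concat_iff.mp hs with h | h
      · rw [List.append_assoc] at h
        exact (List.sum_pos_of_suffix_append hN hP' (sum_list hnd' hmem' ▸ hpos) h hne).ne'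
      · exact hinf s h hne

end Ordered

/-- If no nonempty block of consecutive elements of `l` sums to zero and `l ++ [a]` sums to zero,
then the partial sums of `l ++ [a]` over nonempty prefixes are pairwise distinct. -/
theorem List.sum_take_concat_ne {G : Type*} [AddCommGroup G] {l : List G} {a : G}
    (hl : ∀ s, s <:+: l → s ≠ [] → s.sum ≠ 0) (ha : (l ++ [a]).sum = 0) {i j : ℕ} (hi : 1 ≤ i)
    (hij : i < j) (hj : j ≤ (l ++ [a]).length) :
    ((l ++ [a]).take i).sum ≠ ((l ++ [a]).take j).sum := by
  rw [List.length_append, List.length_singleton] at hj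
  rw [List.take_append_of_le_length (by lia)]
  rcases hj.lt_or_eq with hj | rfl
  · rw [List.take_append_of_le_length (by lia)]
    intro h
    refine hl ((l.take j).drop i) ((List.drop_suffix _ _).isInfix.trans
      (List.take_prefix _ _).isInfix) ?_ ?_
    · rw [← List.length_pos_iff, List.length_drop, List.length_take]
      lia
    · have h' := List.sum_take_add_sum_drop (l.take j) i
      rw [List.take_take, min_eq_left hij.le, h] at h'
      simpa using h'
  · rw [List.take_of_length_le (l := l ++ [a]) (by simp), ha]
    refine hl _ (List.take_prefix _ _).isInfix ?_
    rw [← List.length_pos_iff, List.length_take]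
    lia

theorem stmt19 (G : Type*) [AddCommGroup G]
    (htf : ∀ (n : ℕ) (g : G), 0 < n → n • g = 0 → g = 0)
    (A : Finset G) (hA0 : (0 : G) ∉ A) (hcard : A.card ≤ 12)
    (hsum : ∑ z ∈ A, z = 0) (hpair : ∀ x ∈ A, -x ∉ A) :
    ∃ l : List G, l.Nodup ∧ (∀ x, x ∈ l ↔ x ∈ A) ∧
      ∀ i j : ℕ, 1 ≤ i → i < j → j ≤ l.length → (l.take i).sum ≠ (l.take j).sum := by
  rcases A.eq_empty_or_nonempty with rfl | ⟨a, ha⟩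
  · exact ⟨[], by simp; lia⟩
  have : IsAddTorsionFree G := ⟨fun n hn x y hxy ↦ sub_eq_zero.mp <|
    htf n (x - y) (Nat.pos_of_ne_zero hn) (by rw [nsmul_sub, sub_eq_zero]; exact hxy)⟩
  obtain ⟨_, _⟩ := exists_linearOrder_isOrderedAddMonoid G
  have herase : ∑ z ∈ A.erase a, z + a = 0 := (Finset.sum_erase_add A (fun z ↦ z) ha).trans hsum
  obtain ⟨N, P, -, -, hnd, hmem, hinf⟩ := (A.erase a).exists_neg_append_pos_infix_sum_ne_zero
    (fun h ↦ hA0 (Finset.mem_of_mem_erase h)) (.inr fun h ↦ hA0 (by simp_all))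
  refine ⟨N ++ P ++ [a], ?_, fun x ↦ ?_, fun i j hi hij hj ↦
    List.sum_take_concat_ne hinf ?_ hi hij hj⟩
  · rw [← List.concat_eq_append]
    exact hnd.concat fun h ↦ by simpa [hmem] using List.mem_toFinset.mpr h
  · rw [List.mem_append, ← List.mem_toFinset, hmem, List.mem_singleton, Finset.mem_erase]
    grind
  · have h := List.sum_toFinset (fun z ↦ z) hnd
    rw [hmem, List.map_id'] at h
    rw [List.sum_append, ← h, List.sum_singleton, herase]
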